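/- A vector x in the James Tree space JT is NOT an extreme point of the ball of radius ‖x‖_{JT} if and only if there exists a non-zero vector y ∈ JT such that (1) ‖x‖_{JT} = ‖x+y‖_{JT} = ‖x−y‖_{JT}, and (2) for every x-norming partition P one has ‖y‖_P = 0, i.e. ∑_{α∈S} y(α) = 0 for every segment S ∈ P. -/

import Mathlib

/-! Common framework for the James Tree space `JT`.

The dyadic tree is modelled as `List Bool`, ordered by `List.IsPrefix` (`<+:`). -/

abbrev DyadicNode := List Bool

namespace JTSpace

/-- A segment of the dyadic tree: a linearly ordered, order-convex subset. -/
def IsSegment (S : Set DyadicNode) : Prop :=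
  (∀ a ∈ S, ∀ b ∈ S, a <+: b ∨ b <+: a) ∧
  (∀ a ∈ S, ∀ b ∈ S, ∀ c : DyadicNode, a <+: c → c <+: b → c ∈ S)

/-- A partition: a family of pairwise disjoint segments. -/
def IsPartition (P : Set (Set DyadicNode)) : Prop :=
  (∀ S ∈ P, IsSegment S) ∧ P.PairwiseDisjoint id

/-- The sum of `x` along a set of nodes. -/
noncomputable def segSum (x : DyadicNode → ℝ) (S : Set DyadicNode) : ℝ :=
  ∑' a : S, x a

/-- The square of the value `‖x‖_P` of `x` on the partition `P`. -/
noncomputable def pNormSq (x : DyadicNode → ℝ) (P : Set (Set DyadicNode)) : ℝ :=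
  ∑' S : P, (segSum x S) ^ 2

/-- The set of all values `‖x‖_P²` over partitions `P`. -/
def normSqSet (x : DyadicNode → ℝ) : Set ℝ :=
  {r | ∃ P, IsPartition P ∧ r = pNormSq x P}

/-- The square of the `JT` norm. -/
noncomputable def JTnormSq (x : DyadicNode → ℝ) : ℝ := sSup (normSqSet x)

/-- The `JT` norm of `x`. -/
noncomputable def JTnorm (x : DyadicNode → ℝ) : ℝ := Real.sqrt (JTnormSq x)

/-- The `ℓ₂` norm of `x`. -/
noncomputable def l2norm (x : DyadicNode → ℝ) : ℝ := Real.sqrt (∑' a, (x a) ^ 2)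

def HasBddNorm (x : DyadicNode → ℝ) : Prop := BddAbove (normSqSet x)

/-- `x` belongs to the James Tree space: its norm is finite and it is approximable in the
`JT` norm by finitely supported functions (`JT` is the completion of `c₀₀(T)`). -/
def MemJT (x : DyadicNode → ℝ) : Prop :=
  HasBddNorm x ∧
  ∀ ε > (0 : ℝ), ∃ y : DyadicNode → ℝ, (Function.support y).Finite ∧
    HasBddNorm (x - y) ∧ JTnorm (x - y) ≤ ε

/-- An `x`-norming partition. -/
def IsNormingPartition (x : DyadicNode → ℝ) (P : Set (Set DyadicNode)) : Prop :=
  IsPartition P ∧ pNormSq x P = JTnormSq x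

/-- A complete subtree of the dyadic tree. -/
def IsCompleteSubtree (K : Set DyadicNode) : Prop :=
  ∀ a ∈ K, ∀ b ∈ K, ∀ c : DyadicNode, a <+: c → c <+: b → c ∈ K

/-- The range of `x`: the smallest complete subtree containing the support of `x`. -/
def ran (x : DyadicNode → ℝ) : Set DyadicNode :=
  ⋂₀ {K | IsCompleteSubtree K ∧ Function.support x ⊆ K}

/-- `x` is separated: every two distinct nodes of `ran x` are separated by some
`x`-norming partition. -/
def Separated (x : DyadicNode → ℝ) : Prop :=
  ∀ a ∈ ran x, ∀ b ∈ ran x, a ≠ b →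
    ∃ P, IsNormingPartition x P ∧ ∃ S ∈ P, ∃ S' ∈ P, S ≠ S' ∧ a ∈ S ∧ b ∈ S'

/-- `x` is an extreme point of the ball of radius `‖x‖_{JT}`. -/
def IsExtremePoint (x : DyadicNode → ℝ) : Prop :=
  x ≠ 0 ∧
  ∀ y z : DyadicNode → ℝ, MemJT y → MemJT z →
    ∀ l : ℝ, 0 < l → l < 1 → x = l • y + (1 - l) • z →
      JTnorm y = JTnorm x → JTnorm z = JTnorm x → y = x ∧ z = x

/-- A branch: a maximal segment. -/
def IsBranch (b : Set DyadicNode) : Prop :=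
  IsSegment b ∧ ∀ S : Set DyadicNode, IsSegment S → b ⊆ S → S = b

/-- The wedge rooted at `a`. -/
def wedge (a : DyadicNode) : Set DyadicNode := {b | a <+: b}

/-- The two children of a node. -/
def children (u : DyadicNode) : Set DyadicNode := {u ++ [false], u ++ [true]}

/-- The maximal segment sum starting at `a`:
`S_a(x) = sup { S_s(x) : s a segment with min s = a }`. -/
noncomputable def maxSum (x : DyadicNode → ℝ) (a : DyadicNode) : ℝ :=
  sSup {r | ∃ s : Set DyadicNode, IsSegment s ∧ a ∈ s ∧ (∀ b ∈ s, a <+: b) ∧ r = segSum x s}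

/-- The children of `u` within the subtree spanned by the support of `x`. -/
def supportedChildren (x : DyadicNode → ℝ) (u : DyadicNode) : Set DyadicNode :=
  {c ∈ children u | ∃ b ∈ Function.support x, c <+: b}

/-- A greedy partition for a positive vector `x`: a partition whose segments cover the
support of `x` and such that every segment, at every support node `u` which has a strict
descendant in the support, continues through a child of `u` (within the subtree spanned by
the support) maximizing the maximal segment sum, down to the next element of the support;
at support nodes with no strict descendant in the support, the segment's support ends. -/
def IsGreedyPartition (x : DyadicNode → ℝ) (P : Set (Set DyadicNode)) : Prop :=
  IsPartition P ∧ Function.support x ⊆ ⋃₀ P ∧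
  ∀ s ∈ P, ∀ u ∈ s ∩ Function.support x,
    ((∃ w ∈ Function.support x, u <+: w ∧ u ≠ w) →
      ∃ v ∈ s ∩ Function.support x, u <+: v ∧ u ≠ v ∧
        (∀ w ∈ s ∩ Function.support x, u <+: w → u ≠ w → v <+: w) ∧
        ∃ c ∈ supportedChildren x u, c <+: v ∧
          ∀ k ∈ supportedChildren x u, maxSum x k ≤ maxSum x c) ∧
    ((¬ ∃ w ∈ Function.support x, u <+: w ∧ u ≠ w) →
      ∀ w ∈ s ∩ Function.support x, w <+: u)


/-- A finite family of pairwise disjoint finite segments. -/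
def Fam (F : Finset (Finset DyadicNode)) : Prop :=
  (∀ S ∈ F, IsSegment (S : Set DyadicNode)) ∧ (F : Set (Finset DyadicNode)).PairwiseDisjoint id

/-- The value of `x` on a finite family. -/
noncomputable def Qv (x : DyadicNode → ℝ) (F : Finset (Finset DyadicNode)) : ℝ :=
  ∑ S ∈ F, (∑ a ∈ S, x a) ^ 2

/-- `x` has norm at most `C`, tested on finite families. -/
def Bd (x : DyadicNode → ℝ) (C : ℝ) : Prop := ∀ F, Fam F → Qv x F ≤ C ^ 2

open Classical in
/-- Truncation of a set of nodes to the nodes of length `< n`. -/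
noncomputable def trunc (n : ℕ) (S : Set DyadicNode) : Finset DyadicNode :=
  (List.finite_length_lt Bool n).toFinset.filter (· ∈ S)

theorem mem_trunc {n : ℕ} {S : Set DyadicNode} {a : DyadicNode} :
    a ∈ trunc n S ↔ a.length < n ∧ a ∈ S := by
  simp [trunc]

theorem isSegment_trunc {n : ℕ} {S : Set DyadicNode} (hS : IsSegment S) :
    IsSegment (trunc n S : Set DyadicNode) := by
  constructor
  · intro a ha b hb
    exact hS.1 a (mem_trunc.1 ha).2 b (mem_trunc.1 hb).2
  · intro a ha b hb c hac hcb
    exact mem_trunc.2 ⟨lt_of_le_of_lt hcb.length_le (mem_trunc.1 hb).1,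
      hS.2 a (mem_trunc.1 ha).2 b (mem_trunc.1 hb).2 c hac hcb⟩

theorem tendsto_trunc {x : DyadicNode → ℝ} {S : Set DyadicNode}
    (h : Summable fun a : S => x a) :
    Filter.Tendsto (fun n => ∑ a ∈ trunc n S, x a) Filter.atTop (nhds (segSum x S)) := by
  classical
  have h1 : HasSum (S.indicator x) (segSum x S) := by
    rw [← hasSum_subtype_iff_indicator]
    exact h.hasSum
  have h2 : Filter.Tendsto (fun n => (List.finite_length_lt Bool n).toFinset)
      Filter.atTop Filter.atTop := by
    apply Filter.tendsto_atTop_finset_of_monotone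
    · intro m n hmn a ha
      simp at ha ⊢
      omega
    · intro a
      exact ⟨a.length + 1, by simp⟩
  have h3 := Filter.Tendsto.comp h1 h2
  refine h3.congr ?_
  intro n
  simp [trunc, Finset.sum_filter, Set.indicator_apply]

theorem eventually_sq {x : DyadicNode → ℝ} {S : Set DyadicNode} {e : ℝ} (he : 0 < e) :
    ∀ᶠ n in Filter.atTop, (segSum x S) ^ 2 ≤ (∑ a ∈ trunc n S, x a) ^ 2 + e := by
  by_cases h : Summable fun a : S => x a
  · have h1 := ((tendsto_trunc h).pow 2).add_const e
    filter_upwards [h1.eventually_const_le (by linarith : (segSum x S) ^ 2 < _)] with n hn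
    exact hn
  · have : segSum x S = 0 := tsum_eq_zero_of_not_summable h
    rw [this]
    filter_upwards with n
    have := sq_nonneg (∑ a ∈ trunc n S, x a)
    linarith

theorem eventually_sum {x : DyadicNode → ℝ} (I : Finset (Set DyadicNode)) {e : ℝ}
    (he : 0 < e) :
    ∀ᶠ n in Filter.atTop,
      ∑ S ∈ I, (segSum x S) ^ 2 ≤ ∑ S ∈ I, (∑ a ∈ trunc n S, x a) ^ 2 + e := by
  have hd : 0 < e / (I.card + 1) := by positivity
  have h : ∀ᶠ n in Filter.atTop, ∀ S ∈ I,
      (segSum x S) ^ 2 ≤ (∑ a ∈ trunc n S, x a) ^ 2 + e / (I.card + 1) :=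
    (Filter.eventually_all_finset I).2 fun S _ => eventually_sq hd
  filter_upwards [h] with n hn
  refine (Finset.sum_le_sum hn).trans ?_
  rw [Finset.sum_add_distrib, Finset.sum_const, nsmul_eq_mul]
  have : (I.card : ℝ) * (e / (I.card + 1)) ≤ e := by
    rw [mul_div_assoc', div_le_iff₀ (by positivity)]
    nlinarith
  linarith

theorem fam_trunc {P : Set (Set DyadicNode)} (hP : IsPartition P) (I : Finset (Set DyadicNode))
    (hI : ∀ S ∈ I, S ∈ P) (n : ℕ) :
    ∃ F, Fam F ∧ ∀ x, Qv x F = ∑ S ∈ I, (∑ a ∈ trunc n S, x a) ^ 2 := by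
  classical
  have hd : (I : Set (Set DyadicNode)).PairwiseDisjoint (trunc n) := by
    intro S hS T hT hST
    have h := hP.2 (hI S hS) (hI T hT) hST
    rw [Function.onFun, Finset.disjoint_left]
    intro a ha hb
    exact Set.disjoint_left.1 h (mem_trunc.1 ha).2 (mem_trunc.1 hb).2
  refine ⟨I.image (trunc n), ⟨?_, ?_⟩, ?_⟩
  · intro S hS
    obtain ⟨T, hT, rfl⟩ := Finset.mem_image.1 hS
    exact isSegment_trunc (hP.1 T (hI T hT))
  · intro S hS T hT hST
    obtain ⟨S', hS', rfl⟩ := Finset.mem_image.1 hS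
    obtain ⟨T', hT', rfl⟩ := Finset.mem_image.1 hT
    exact hd hS' hT' (fun h => hST (by rw [h]))
  · intro x
    exact Finset.sum_image_of_disjoint (g := fun S : Finset DyadicNode => (∑ a ∈ S, x a) ^ 2)
      (by simp) hd

theorem Qv_mem (x : DyadicNode → ℝ) {F : Finset (Finset DyadicNode)} (hF : Fam F) :
    Qv x F ∈ normSqSet x := by
  refine ⟨(fun S : Finset DyadicNode => (S : Set DyadicNode)) '' (F : Set (Finset DyadicNode)),
    ⟨?_, ?_⟩, ?_⟩
  · rintro _ ⟨S, hS, rfl⟩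
    exact hF.1 S hS
  · rintro _ ⟨S, hS, rfl⟩ _ ⟨T, hT, rfl⟩ hST
    have := hF.2 hS hT (fun h => hST (by rw [h]))
    exact Finset.disjoint_coe.2 this
  · unfold pNormSq
    rw [tsum_image (f := fun S => (segSum x S) ^ 2) Finset.coe_injective.injOn]
    rw [Finset.tsum_subtype' F (fun S : Finset DyadicNode => (segSum x (S : Set DyadicNode)) ^ 2)]
    refine Finset.sum_congr rfl fun S _ => ?_
    rw [segSum, Finset.tsum_subtype' S x]

theorem JTnormSq_nonneg (x : DyadicNode → ℝ) : 0 ≤ JTnormSq x := by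
  apply Real.sSup_nonneg
  rintro _ ⟨P, _, rfl⟩
  exact tsum_nonneg fun _ => sq_nonneg _

theorem JTnorm_sq (x : DyadicNode → ℝ) : JTnorm x ^ 2 = JTnormSq x :=
  Real.sq_sqrt (JTnormSq_nonneg x)

theorem JTnorm_nonneg (x : DyadicNode → ℝ) : 0 ≤ JTnorm x := Real.sqrt_nonneg _

theorem bd_of_bdd {x : DyadicNode → ℝ} (h : HasBddNorm x) : Bd x (JTnorm x) := by
  intro F hF
  rw [JTnorm_sq]
  exact le_csSup h (Qv_mem x hF)

theorem sum_le_of_bd {x : DyadicNode → ℝ} {C : ℝ} (h : Bd x C) {P : Set (Set DyadicNode)}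
    (hP : IsPartition P) (I : Finset P) : ∑ S ∈ I, (segSum x S) ^ 2 ≤ C ^ 2 := by
  classical
  have h1 : ∑ S ∈ I, (segSum x S) ^ 2 =
      ∑ S ∈ I.map (Function.Embedding.subtype _), (segSum x S) ^ 2 := by
    rw [Finset.sum_map]; rfl
  rw [h1]
  refine le_of_forall_pos_le_add fun e he => ?_
  obtain ⟨n, hn⟩ := (eventually_sum (x := x) (I.map (Function.Embedding.subtype _)) he).exists
  obtain ⟨F, hF, hQ⟩ := fam_trunc hP (I.map (Function.Embedding.subtype _))
    (by intro S hS; obtain ⟨T, _, rfl⟩ := Finset.mem_map.1 hS; exact T.2) n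
  have := h F hF
  rw [hQ] at this
  linarith

theorem bdd_of_bd {x : DyadicNode → ℝ} {C : ℝ} (hC : 0 ≤ C) (h : Bd x C) :
    HasBddNorm x ∧ JTnorm x ≤ C := by
  have h1 : ∀ r ∈ normSqSet x, r ≤ C ^ 2 := by
    rintro _ ⟨P, hP, rfl⟩
    exact Real.tsum_le_of_sum_le (fun _ => sq_nonneg _) (fun I => sum_le_of_bd h hP I)
  refine ⟨⟨C ^ 2, h1⟩, ?_⟩
  apply Real.sqrt_le_iff.2 ⟨hC, Real.sSup_le h1 (sq_nonneg C)⟩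

theorem Bd.add {x y : DyadicNode → ℝ} {C D : ℝ} (hC : 0 ≤ C) (hD : 0 ≤ D)
    (hx : Bd x C) (hy : Bd y D) : Bd (x + y) (C + D) := by
  intro F hF
  have h1 := hx F hF
  have h2 := hy F hF
  have h3 := Finset.sum_mul_sq_le_sq_mul_sq F (fun S => ∑ a ∈ S, x a) (fun S => ∑ a ∈ S, y a)
  have h4 : Qv (x + y) F = Qv x F + Qv y F +
      2 * ∑ S ∈ F, (∑ a ∈ S, x a) * (∑ a ∈ S, y a) := by
    unfold Qv
    rw [Finset.mul_sum, ← Finset.sum_add_distrib, ← Finset.sum_add_distrib]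
    refine Finset.sum_congr rfl fun S _ => ?_
    simp only [Pi.add_apply, Finset.sum_add_distrib]
    ring
  have h5 : 0 ≤ Qv y F := Finset.sum_nonneg fun _ _ => sq_nonneg _
  have h6 : (∑ S ∈ F, (∑ a ∈ S, x a) * (∑ a ∈ S, y a)) ^ 2 ≤ (C * D) ^ 2 := by
    refine h3.trans ?_
    rw [mul_pow]
    exact mul_le_mul h1 h2 h5 (sq_nonneg _)
  have h7 := abs_le_of_sq_le_sq h6 (mul_nonneg hC hD)
  rw [h4]
  nlinarith [(abs_le.1 h7).2]

theorem Bd.smul {x : DyadicNode → ℝ} {C : ℝ} (hx : Bd x C) (c : ℝ) : Bd (c • x) (|c| * C) := by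
  intro F hF
  have h1 := hx F hF
  have h4 : Qv (c • x) F = c ^ 2 * Qv x F := by
    unfold Qv
    rw [Finset.mul_sum]
    refine Finset.sum_congr rfl fun S _ => ?_
    simp only [Pi.smul_apply, smul_eq_mul, ← Finset.mul_sum]
    ring
  rw [h4, mul_pow, sq_abs]
  exact mul_le_mul_of_nonneg_left h1 (sq_nonneg c)

theorem norm_add {x y : DyadicNode → ℝ} (hx : HasBddNorm x) (hy : HasBddNorm y) :
    HasBddNorm (x + y) ∧ JTnorm (x + y) ≤ JTnorm x + JTnorm y :=
  bdd_of_bd (add_nonneg (JTnorm_nonneg x) (JTnorm_nonneg y))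
    (Bd.add (JTnorm_nonneg x) (JTnorm_nonneg y) (bd_of_bdd hx) (bd_of_bdd hy))

theorem norm_smul' {x : DyadicNode → ℝ} (hx : HasBddNorm x) (c : ℝ) :
    HasBddNorm (c • x) ∧ JTnorm (c • x) ≤ |c| * JTnorm x :=
  bdd_of_bd (mul_nonneg (abs_nonneg c) (JTnorm_nonneg x)) ((bd_of_bdd hx).smul c)

theorem MemJT.add {x y : DyadicNode → ℝ} (hx : MemJT x) (hy : MemJT y) : MemJT (x + y) := by
  refine ⟨(norm_add hx.1 hy.1).1, fun e he => ?_⟩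
  obtain ⟨u, hu, hu1, hu2⟩ := hx.2 (e / 2) (by positivity)
  obtain ⟨v, hv, hv1, hv2⟩ := hy.2 (e / 2) (by positivity)
  have h := norm_add hu1 hv1
  rw [show x - u + (y - v) = x + y - (u + v) by abel] at h
  exact ⟨u + v, (hu.union hv).subset (Function.support_add u v), h.1, by linarith [h.2]⟩

theorem MemJT.smul {x : DyadicNode → ℝ} (hx : MemJT x) (c : ℝ) : MemJT (c • x) := by
  refine ⟨(norm_smul' hx.1 c).1, fun e he => ?_⟩
  obtain ⟨u, hu, hu1, hu2⟩ := hx.2 (e / (|c| + 1)) (by positivity)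
  have h := norm_smul' hu1 c
  rw [smul_sub] at h
  refine ⟨c • u, hu.subset (Function.support_const_smul_subset c u), h.1, h.2.trans ?_⟩
  have h1 : |c| * JTnorm (x - u) ≤ |c| * (e / (|c| + 1)) :=
    mul_le_mul_of_nonneg_left hu2 (abs_nonneg c)
  have h2 : |c| * (e / (|c| + 1)) ≤ e := by
    rw [mul_div_assoc', div_le_iff₀ (by positivity)]
    nlinarith
  linarith

theorem MemJT.sub {x y : DyadicNode → ℝ} (hx : MemJT x) (hy : MemJT y) : MemJT (x - y) := by
  have := hx.add (hy.smul (-1))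
  rwa [neg_one_smul, ← sub_eq_add_neg] at this

theorem segSum_zero {x y : DyadicNode → ℝ} (hx : MemJT x)
    (h1 : Bd (x + y) (JTnorm x)) (h2 : Bd (x - y) (JTnorm x))
    {P : Set (Set DyadicNode)} (hP : IsNormingPartition x P) {S₀ : Set DyadicNode}
    (hS : S₀ ∈ P) : segSum y S₀ = 0 := by
  classical
  by_contra hs
  set e := (segSum y S₀) ^ 2 / 4 with he_def
  have he : 0 < e := by positivity
  have hsum : Summable fun S : P => (segSum x S) ^ 2 :=
    summable_of_sum_le (fun _ => sq_nonneg _) (fun I => sum_le_of_bd (bd_of_bdd hx.1) hP.1 I)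
  have hval : HasSum (fun S : P => (segSum x S) ^ 2) (JTnormSq x) := by
    rw [← hP.2]; exact hsum.hasSum
  have hev := hval.eventually_const_le (by linarith : JTnormSq x - e < JTnormSq x)
  obtain ⟨I, hI1, hI2⟩ := (hev.and (Filter.eventually_ge_atTop {⟨S₀, hS⟩})).exists
  have hmem : S₀ ∈ I.map (Function.Embedding.subtype _) := by
    rw [Finset.mem_map]
    exact ⟨⟨S₀, hS⟩, hI2 (Finset.mem_singleton_self _), rfl⟩
  have hI3 : ∑ S ∈ I, (segSum x S) ^ 2 =
      ∑ S ∈ I.map (Function.Embedding.subtype _), (segSum x S) ^ 2 := by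
    rw [Finset.sum_map]; rfl
  rw [hI3] at hI1
  obtain ⟨n, hn1, hn2⟩ := ((eventually_sum (x := x) (I.map (Function.Embedding.subtype _)) he).and
    (eventually_sq (x := y) (S := S₀) he)).exists
  obtain ⟨F, hF, hQ⟩ := fam_trunc hP.1 (I.map (Function.Embedding.subtype _))
    (by intro S hS; obtain ⟨T, _, rfl⟩ := Finset.mem_map.1 hS; exact T.2) n
  have hy : (∑ a ∈ trunc n S₀, y a) ^ 2 ≤ Qv y F := by
    rw [hQ]
    exact Finset.single_le_sum (f := fun S => (∑ a ∈ trunc n S, y a) ^ 2)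
      (fun _ _ => sq_nonneg _) hmem
  have hpar : Qv (x + y) F + Qv (x - y) F = 2 * Qv x F + 2 * Qv y F := by
    unfold Qv
    rw [Finset.mul_sum, Finset.mul_sum, ← Finset.sum_add_distrib, ← Finset.sum_add_distrib]
    refine Finset.sum_congr rfl fun S _ => ?_
    simp only [Pi.add_apply, Pi.sub_apply, Finset.sum_add_distrib, Finset.sum_sub_distrib]
    ring
  have h3 := h1 F hF
  have h4 := h2 F hF
  rw [JTnorm_sq] at h3 h4
  rw [← hQ] at hn1
  linarith

/-- `x ∈ JT` is not an extreme point of the ball of radius `‖x‖_{JT}` iff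
there exists a non-zero `y ∈ JT` with `‖x‖ = ‖x+y‖ = ‖x-y‖` and `∑_{α∈S} y(α) = 0` for
every segment `S` of every `x`-norming partition. -/
theorem not_extreme_iff (x : DyadicNode → ℝ) (hx : MemJT x) (hx0 : x ≠ 0) :
    ¬ IsExtremePoint x ↔
      ∃ y : DyadicNode → ℝ, MemJT y ∧ y ≠ 0 ∧
        JTnorm (x + y) = JTnorm x ∧ JTnorm (x - y) = JTnorm x ∧
        ∀ P : Set (Set DyadicNode), IsNormingPartition x P → ∀ S ∈ P, segSum y S = 0 := by
  constructor
  · intro h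
    have h' : ∃ u v : DyadicNode → ℝ, MemJT u ∧ MemJT v ∧ ∃ l : ℝ, 0 < l ∧ l < 1 ∧
        x = l • u + (1 - l) • v ∧ JTnorm u = JTnorm x ∧ JTnorm v = JTnorm x ∧
        ¬ (u = x ∧ v = x) := by
      by_contra hc
      apply h
      refine ⟨hx0, fun u v hu hv l h0 h1 h2 h3 h4 => ?_⟩
      by_contra h5
      exact hc ⟨u, v, hu, hv, l, h0, h1, h2, h3, h4, h5⟩
    obtain ⟨u, v, hu, hv, l, h0, h1, hxe, hun, hvn, hne⟩ := h'
    set t := min l (1 - l) with ht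
    have ht0 : 0 < t := lt_min h0 (by linarith)
    have htl : t ≤ l := min_le_left _ _
    have htl' : t ≤ 1 - l := min_le_right _ _
    have hy : MemJT (t • (u - v)) := (hu.sub hv).smul t
    have key : ∀ m : ℝ, 0 ≤ m → m ≤ 1 → HasBddNorm (m • u + (1 - m) • v) ∧
        JTnorm (m • u + (1 - m) • v) ≤ JTnorm x := by
      intro m hm0 hm1
      have a := norm_smul' hu.1 m
      have b := norm_smul' hv.1 (1 - m)
      have c := norm_add a.1 b.1
      refine ⟨c.1, c.2.trans ?_⟩
      rw [abs_of_nonneg hm0, hun] at a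
      rw [abs_of_nonneg (by linarith), hvn] at b
      linarith [a.2, b.2]
    have hp := key (l + t) (by linarith) (by linarith)
    have hm := key (l - t) (by linarith) (by linarith)
    rw [show (l + t) • u + (1 - (l + t)) • v = x + t • (u - v) by rw [hxe]; module] at hp
    rw [show (l - t) • u + (1 - (l - t)) • v = x - t • (u - v) by rw [hxe]; module] at hm
    have hmid := norm_add (norm_smul' hp.1 (1 / 2)).1 (norm_smul' hm.1 (1 / 2)).1
    rw [show (1 / 2 : ℝ) • (x + t • (u - v)) + (1 / 2 : ℝ) • (x - t • (u - v)) = x by module]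
      at hmid
    have a := (norm_smul' hp.1 (1 / 2)).2
    have b := (norm_smul' hm.1 (1 / 2)).2
    rw [abs_of_nonneg (by norm_num)] at a b
    have hpe : JTnorm (x + t • (u - v)) = JTnorm x := by
      apply le_antisymm hp.2; linarith [hmid.2, hm.2]
    have hme : JTnorm (x - t • (u - v)) = JTnorm x := by
      apply le_antisymm hm.2; linarith [hmid.2, hp.2]
    refine ⟨t • (u - v), hy, ?_, hpe, hme, ?_⟩
    · intro h0
      have huv : u = v := by
        rcases smul_eq_zero.1 h0 with h | h
        · exact absurd h ht0.ne'
        · exact sub_eq_zero.1 h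
      apply hne
      subst huv
      have : x = u := by rw [hxe]; module
      exact ⟨this.symm, this.symm⟩
    · intro P hP S hS
      have hb1 := bd_of_bdd hp.1
      have hb2 := bd_of_bdd hm.1
      rw [hpe] at hb1
      rw [hme] at hb2
      exact segSum_zero hx hb1 hb2 hP hS
  · rintro ⟨y, hy, hy0, h1, h2, -⟩ ⟨-, h⟩
    have := h (x + y) (x - y) (hx.add hy) (hx.sub hy) (1 / 2) (by norm_num) (by norm_num)
      (by module) h1 h2
    exact hy0 (by simpa using this.1)

end JTSpace
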